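/- (Theorem 1, ZeroSARAH.) Suppose n ≥ 2, f is bounded below with f* := inf_x f(x), λ_0 = 1 and λ_k ∈ (0,1] for all k ≥ 1, 1 ≤ b_k ≤ n for all k, and the stepsizes satisfy η_k ≤ 1/(L(1 + √M_{k+1})) for all k ≥ 0, where M_{k+1} := 2/(λ_{k+1} b_{k+1}) + 8 λ_{k+1} n² / b_{k+1}³. Suppose moreover the sequences (η_{k−1}/λ_k)_{k≥1} and (λ_k η_{k−1}/b_k²)_{k≥1} are nonincreasing, and let γ_0 ≥ η_0/(2λ_1) and α_0 ≥ 2 n λ_1 η_0 / b_1². Then for every K ≥ 1, the ZeroSARAH iterates satisfy ∑_{k=0}^{K−1} η_k · E[‖∇f(x^k)‖²] ≤ 2(f(x⁰) − f*) + ((n − b_0)(4γ_0 + 2α_0 b_0)/(n b_0)) · G_0; equivalently, (∑_{k=0}^{K−1} η_k E[‖∇f(x^k)‖²]) / (∑_{k=0}^{K−1} η_k) ≤ 2Δ_0/∑_{k=0}^{K−1}η_k + (n−b_0)(4γ_0 + 2α_0 b_0) G_0 / (n b_0 ∑_{k=0}^{K−1} η_k). -/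

import Mathlib

noncomputable section

/-- The average function `f = (1/n) ∑ᵢ fᵢ`. -/
noncomputable def avgF {d n : ℕ} (f : Fin n → EuclideanSpace ℝ (Fin d) → ℝ) :
    EuclideanSpace ℝ (Fin d) → ℝ :=
  fun z => (n : ℝ)⁻¹ * ∑ i, f i z

/-- The ZeroSARAH random process.  Given a draw `ω : ℕ → Finset (Fin n)` of minibatches,
`zsState f η lam b x0 ω k = (xᵏ, xᵏ⁻¹, vᵏ⁻¹, y^{k−1})`, with
`x⁻¹ = x⁰`, `v⁻¹ = 0`, `y⁻¹ = 0`, and at each step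
`vᵏ = (1/bₖ)∑_{i∈Iₖ}(∇fᵢ(xᵏ) − ∇fᵢ(xᵏ⁻¹)) + (1−λₖ)vᵏ⁻¹
     + λₖ[(1/bₖ)∑_{i∈Iₖ}(∇fᵢ(xᵏ⁻¹) − yᵢᵏ⁻¹) + (1/n)∑ⱼ yⱼᵏ⁻¹]`,
`xᵏ⁺¹ = xᵏ − ηₖ vᵏ`, `yᵢᵏ = ∇fᵢ(xᵏ)` for `i ∈ Iₖ`, `yᵢᵏ = yᵢᵏ⁻¹` otherwise. -/
noncomputable def zsState {d n : ℕ} (f : Fin n → EuclideanSpace ℝ (Fin d) → ℝ)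
    (η lam : ℕ → ℝ) (b : ℕ → ℕ) (x0 : EuclideanSpace ℝ (Fin d))
    (ω : ℕ → Finset (Fin n)) :
    ℕ → EuclideanSpace ℝ (Fin d) × EuclideanSpace ℝ (Fin d) ×
      EuclideanSpace ℝ (Fin d) × (Fin n → EuclideanSpace ℝ (Fin d))
  | 0 => (x0, x0, 0, fun _ => 0)
  | (k + 1) =>
      let st := zsState f η lam b x0 ω k
      let v : EuclideanSpace ℝ (Fin d) :=
        (b k : ℝ)⁻¹ • ∑ i ∈ ω k, (gradient (f i) st.1 - gradient (f i) st.2.1)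
          + (1 - lam k) • st.2.2.1
          + lam k • ((b k : ℝ)⁻¹ • ∑ i ∈ ω k, (gradient (f i) st.2.1 - st.2.2.2 i)
              + (n : ℝ)⁻¹ • ∑ j, st.2.2.2 j)
      (st.1 - η k • v, st.1, v,
        fun i => if i ∈ ω k then gradient (f i) st.1 else st.2.2.2 i)

/-- Expectation over the first `k` independent uniformly random minibatches
`I₀, …, I_{k−1}` with `|Iⱼ| = bⱼ`, of a functional of the whole draw. -/
noncomputable def zsExpK {n : ℕ} (b : ℕ → ℕ) (k : ℕ)
    (g : (ℕ → Finset (Fin n)) → ℝ) : ℝ :=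
  (∑ τ ∈ Finset.univ.filter
      (fun τ : Fin k → Finset (Fin n) => ∀ j : Fin k, (τ j).card = b j.val),
    g (fun j => if h : j < k then τ ⟨j, h⟩ else ∅)) /
  ((Finset.univ.filter
      (fun τ : Fin k → Finset (Fin n) => ∀ j : Fin k, (τ j).card = b j.val)).card : ℝ)


/-- number of size-`b` subsets containing `i` and `j` -/
def zsN {n : ℕ} (b : ℕ) (i j : Fin n) : ℝ :=
  ∑ I ∈ Finset.powersetCard b (Finset.univ : Finset (Fin n)), (if i ∈ I ∧ j ∈ I then (1 : ℝ) else 0)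

lemma zsN_perm {n : ℕ} (b : ℕ) (σ : Equiv.Perm (Fin n)) (i j : Fin n) :
    zsN b (σ i) (σ j) = zsN b i j := by
  unfold zsN
  symm
  refine Finset.sum_nbij' (fun I => I.map σ.toEmbedding) (fun I => I.map σ.symm.toEmbedding)
    ?_ ?_ ?_ ?_ ?_
  · intro I hI
    simpa [Finset.mem_powersetCard] using hI
  · intro I hI
    simpa [Finset.mem_powersetCard] using hI
  · intro I _
    ext x; simp
  · intro I _
    ext x; simp
  · intro I _
    simp

lemma zsN_diag {n : ℕ} (b : ℕ) (i j : Fin n) : zsN b i i = zsN b j j := by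
  have := zsN_perm b (Equiv.swap i j) j j
  simpa using this

lemma zsN_off {n : ℕ} (b : ℕ) (i j k : Fin n) (hj : j ≠ i) (hk : k ≠ i) :
    zsN b i j = zsN b i k := by
  have := zsN_perm b (Equiv.swap j k) i k
  rwa [Equiv.swap_apply_of_ne_of_ne hj.symm hk.symm, Equiv.swap_apply_right] at this

lemma zsN_sum {n : ℕ} (b : ℕ) (i : Fin n) : ∑ j, zsN b i j = b * zsN b i i := by
  unfold zsN
  rw [Finset.sum_comm, Finset.mul_sum]
  refine Finset.sum_congr rfl fun I hI => ?_
  have hc := (Finset.mem_powersetCard.1 hI).2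
  by_cases h : i ∈ I
  · simp [h, hc]
  · simp [h]

lemma zsN_sum_diag {n : ℕ} (b : ℕ) :
    ∑ i : Fin n, zsN b i i = b * (n.choose b : ℝ) := by
  unfold zsN
  rw [Finset.sum_comm]
  have : ∀ I ∈ Finset.powersetCard b (Finset.univ : Finset (Fin n)),
      (∑ i, if i ∈ I ∧ i ∈ I then (1 : ℝ) else 0) = b := by
    intro I hI
    have hc := (Finset.mem_powersetCard.1 hI).2
    simp [hc]
  rw [Finset.sum_congr rfl this]
  simp [mul_comm]

lemma zsN_diag_eq {n : ℕ} (hn : 2 ≤ n) (b : ℕ) (i : Fin n) :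
    zsN b i i = b / n * (n.choose b : ℝ) := by
  have h := zsN_sum_diag (n := n) b
  rw [Finset.sum_congr rfl (fun j _ => zsN_diag b j i)] at h
  simp at h
  have hn0 : (n : ℝ) ≠ 0 := by positivity
  field_simp
  linarith

lemma zsN_off_eq {n : ℕ} (hn : 2 ≤ n) (b : ℕ) (i j : Fin n) (hj : j ≠ i) :
    zsN b i j = (b - 1) / (n - 1) * zsN b i i := by
  have h := zsN_sum b i
  rw [← Finset.add_sum_erase _ _ (Finset.mem_univ i),
    Finset.sum_congr rfl (fun k hk => zsN_off b i k j (Finset.ne_of_mem_erase hk) hj)] at h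
  simp [Finset.card_erase_of_mem] at h
  have hn0 : (n : ℝ) - 1 ≠ 0 := by
    have : (2 : ℝ) ≤ n := by exact_mod_cast hn
    linarith
  rw [Nat.cast_sub (by omega)] at h
  field_simp
  push_cast at h
  linarith

/-- average over minibatches of size `b` -/
def zsAvg {n : ℕ} (b : ℕ) (φ : Finset (Fin n) → ℝ) : ℝ :=
  (∑ I ∈ Finset.powersetCard b (Finset.univ : Finset (Fin n)), φ I) / (n.choose b : ℝ)

lemma zsAvg_add {n : ℕ} (b : ℕ) (φ ψ : Finset (Fin n) → ℝ) :
    zsAvg b (fun I => φ I + ψ I) = zsAvg b φ + zsAvg b ψ := by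
  simp [zsAvg, Finset.sum_add_distrib, add_div]

lemma zsAvg_mul {n : ℕ} (b : ℕ) (c : ℝ) (φ : Finset (Fin n) → ℝ) :
    zsAvg b (fun I => c * φ I) = c * zsAvg b φ := by
  simp [zsAvg, ← Finset.mul_sum, mul_div_assoc]

lemma zsAvg_const {n : ℕ} (b : ℕ) (hb : b ≤ n) (c : ℝ) :
    zsAvg (n := n) b (fun _ => c) = c := by
  have : (n.choose b : ℝ) ≠ 0 := by exact_mod_cast (Nat.choose_pos hb).ne'
  simp [zsAvg, this]

lemma zsAvg_sum {n : ℕ} {ι : Type*} (s : Finset ι) (b : ℕ) (φ : ι → Finset (Fin n) → ℝ) :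
    zsAvg b (fun I => ∑ i ∈ s, φ i I) = ∑ i ∈ s, zsAvg b (φ i) := by
  simp only [zsAvg]
  rw [Finset.sum_comm, Finset.sum_div]

lemma zsAvg_mem {n : ℕ} (hn : 2 ≤ n) (b : ℕ) (hb : b ≤ n) (i : Fin n) (c : ℝ) :
    zsAvg b (fun I => if i ∈ I then c else 0) = b / n * c := by
  have h := zsN_diag_eq hn b i
  have h0 : (n.choose b : ℝ) ≠ 0 := by exact_mod_cast (Nat.choose_pos hb).ne'
  have : (fun I : Finset (Fin n) => if i ∈ I then c else 0)
      = fun I => c * (if i ∈ I ∧ i ∈ I then (1 : ℝ) else 0) := by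
    funext I; simp
  rw [this, zsAvg_mul, zsAvg, ← zsN, h]
  field_simp

lemma zsAvg_mem2 {n : ℕ} (hn : 2 ≤ n) (b : ℕ) (hb : b ≤ n) (i j : Fin n) (hj : j ≠ i) (c : ℝ) :
    zsAvg b (fun I => if i ∈ I ∧ j ∈ I then c else 0) = b / n * ((b - 1) / (n - 1)) * c := by
  have h := zsN_diag_eq hn b i
  have h2 := zsN_off_eq hn b i j hj
  have h0 : (n.choose b : ℝ) ≠ 0 := by exact_mod_cast (Nat.choose_pos hb).ne'
  have : (fun I : Finset (Fin n) => if i ∈ I ∧ j ∈ I then c else 0)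
      = fun I => c * (if i ∈ I ∧ j ∈ I then (1 : ℝ) else 0) := by
    funext I; simp
  rw [this, zsAvg_mul, zsAvg, ← zsN, h2, h]
  field_simp

lemma zsAvg_normsq {n : ℕ} {E : Type*} [NormedAddCommGroup E] [InnerProductSpace ℝ E]
    (hn : 2 ≤ n) (b : ℕ) (hb : b ≤ n) (c : Fin n → E) (hc : ∑ i, c i = 0) :
    zsAvg b (fun I => ‖∑ i ∈ I, c i‖ ^ 2)
      = b / n * (1 - (b - 1) / (n - 1)) * ∑ i, ‖c i‖ ^ 2 := by
  have e : (fun I : Finset (Fin n) => ‖∑ i ∈ I, c i‖ ^ 2) =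
      fun I => ∑ i, ∑ j, if i ∈ I ∧ j ∈ I then inner ℝ (c i) (c j) else (0 : ℝ) := by
    funext I
    rw [← real_inner_self_eq_norm_sq, sum_inner]
    simp_rw [inner_sum]
    simp [ite_and, Finset.sum_ite_mem]
  rw [e, zsAvg_sum]
  simp_rw [zsAvg_sum]
  have key : ∀ i, ∑ j, zsAvg b (fun I : Finset (Fin n) =>
      if i ∈ I ∧ j ∈ I then inner ℝ (c i) (c j) else (0 : ℝ))
      = b / n * (1 - (b - 1) / (n - 1)) * ‖c i‖ ^ 2 := by
    intro i
    have hsum : ∑ j, (inner ℝ (c i) (c j) : ℝ) = 0 := by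
      rw [← inner_sum, hc, inner_zero_right]
    rw [← Finset.add_sum_erase _ _ (Finset.mem_univ i)] at hsum ⊢
    rw [Finset.sum_congr rfl (fun j hj => zsAvg_mem2 hn b hb i j (Finset.ne_of_mem_erase hj) _),
      ← Finset.mul_sum]
    have h1 := zsAvg_mem hn b hb i (inner ℝ (c i) (c i))
    simp only [and_self]
    rw [h1]
    have h2 : ∑ j ∈ Finset.univ.erase i, (inner ℝ (c i) (c j) : ℝ) = - inner ℝ (c i) (c i) := by
      linarith
    rw [h2, real_inner_self_eq_norm_sq]
    ring
  simp_rw [key]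
  rw [← Finset.mul_sum]

lemma zsAvg_lin {n : ℕ} {E : Type*} [NormedAddCommGroup E] [InnerProductSpace ℝ E]
    (hn : 2 ≤ n) (b : ℕ) (hb : b ≤ n) (u : E) (c : Fin n → E) (hc : ∑ i, c i = 0) :
    zsAvg b (fun I => (inner ℝ u (∑ i ∈ I, c i) : ℝ)) = 0 := by
  have e : (fun I : Finset (Fin n) => (inner ℝ u (∑ i ∈ I, c i) : ℝ)) =
      fun I => ∑ i, if i ∈ I then (inner ℝ u (c i) : ℝ) else 0 := by
    funext I
    rw [inner_sum]
    simp [Finset.sum_ite_mem]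
  rw [e, zsAvg_sum, Finset.sum_congr rfl (fun i _ => zsAvg_mem hn b hb i _), ← Finset.mul_sum,
    ← inner_sum, hc, inner_zero_right, mul_zero]

lemma sum_center_sq {n : ℕ} {E : Type*} [NormedAddCommGroup E] [InnerProductSpace ℝ E]
    (hn : 2 ≤ n) (c : Fin n → E) :
    ∑ i, ‖c i - (n : ℝ)⁻¹ • ∑ j, c j‖ ^ 2 ≤ ∑ i, ‖c i‖ ^ 2 := by
  set m := (n : ℝ)⁻¹ • ∑ j, c j with hm
  have hn0 : (n : ℝ) ≠ 0 := by positivity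
  have hs : ∑ j, c j = (n : ℝ) • m := by rw [hm, smul_inv_smul₀ hn0]
  have : ∀ i, ‖c i - m‖ ^ 2 = ‖c i‖ ^ 2 - 2 * inner ℝ (c i) m + ‖m‖ ^ 2 := fun i =>
    norm_sub_sq_real _ _
  simp_rw [this]
  rw [Finset.sum_add_distrib, Finset.sum_sub_distrib, ← Finset.mul_sum, ← sum_inner, hs,
    inner_smul_left, real_inner_self_eq_norm_sq]
  simp
  nlinarith [mul_nonneg (Nat.cast_nonneg (α := ℝ) n) (sq_nonneg ‖m‖)]

/-- The variance of the minibatch mean. -/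
lemma zsAvg_var {n : ℕ} {E : Type*} [NormedAddCommGroup E] [InnerProductSpace ℝ E]
    (hn : 2 ≤ n) (b : ℕ) (hb1 : 1 ≤ b) (hb : b ≤ n) (u : E) (c : Fin n → E) :
    zsAvg b (fun I => ‖u + ((b : ℝ)⁻¹ • ∑ i ∈ I, c i - (n : ℝ)⁻¹ • ∑ j, c j)‖ ^ 2)
      ≤ ‖u‖ ^ 2 + ((n - b) / ((n - 1) * b)) * ((n : ℝ)⁻¹ * ∑ i, ‖c i‖ ^ 2) := by
  set m := (n : ℝ)⁻¹ • ∑ j, c j with hm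
  have hn0 : (n : ℝ) ≠ 0 := by positivity
  have hb0 : (b : ℝ) ≠ 0 := by positivity
  have hn2 : (2 : ℝ) ≤ n := by exact_mod_cast hn
  have hbn : (b : ℝ) ≤ n := by exact_mod_cast hb
  have hb1' : (1 : ℝ) ≤ b := by exact_mod_cast hb1
  have hs : ∑ j, c j = (n : ℝ) • m := by rw [hm, smul_inv_smul₀ hn0]
  have hc : ∑ i, (c i - m) = 0 := by
    rw [Finset.sum_sub_distrib, hs]; simp [Nat.cast_smul_eq_nsmul]
  have e : zsAvg b (fun I => ‖u + ((b : ℝ)⁻¹ • ∑ i ∈ I, c i - m)‖ ^ 2)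
      = zsAvg b (fun I => ‖u‖ ^ 2 + (2 * (b : ℝ)⁻¹ * inner ℝ u (∑ i ∈ I, (c i - m))
        + ((b : ℝ)⁻¹ ^ 2) * ‖∑ i ∈ I, (c i - m)‖ ^ 2)) := by
    unfold zsAvg
    congr 1
    refine Finset.sum_congr rfl fun I hI => ?_
    have hcard := (Finset.mem_powersetCard.1 hI).2
    have : (b : ℝ)⁻¹ • ∑ i ∈ I, c i - m = (b : ℝ)⁻¹ • ∑ i ∈ I, (c i - m) := by
      rw [Finset.sum_sub_distrib, smul_sub]
      simp [hcard, ← Nat.cast_smul_eq_nsmul ℝ, smul_smul, hb0]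
    show ‖u + ((b : ℝ)⁻¹ • ∑ i ∈ I, c i - m)‖ ^ 2 = ‖u‖ ^ 2 + (2 * (b : ℝ)⁻¹ * inner ℝ u (∑ i ∈ I, (c i - m))
        + ((b : ℝ)⁻¹ ^ 2) * ‖∑ i ∈ I, (c i - m)‖ ^ 2)
    rw [this, norm_add_sq_real, inner_smul_right, norm_smul, mul_pow]
    simp
    ring
  rw [e, zsAvg_add, zsAvg_add, zsAvg_mul, zsAvg_mul, zsAvg_lin hn b hb u _ hc,
    zsAvg_normsq hn b hb _ hc, zsAvg_const b hb]
  have h1 := sum_center_sq hn c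
  rw [← hm] at h1
  have hnm : (0 : ℝ) < n - 1 := by linarith
  have hcoef : (b : ℝ)⁻¹ ^ 2 * (b / n * (1 - (b - 1) / (n - 1)))
      = ((n - b) / ((n - 1) * b)) * (n : ℝ)⁻¹ := by
    field_simp
    ring
  have h3 : (0 : ℝ) ≤ ((n - b) / ((n - 1) * b)) * (n : ℝ)⁻¹ := by
    have : (0 : ℝ) ≤ n - b := by linarith
    positivity
  rw [mul_zero, zero_add, ← mul_assoc, hcoef, ← mul_assoc]
  gcongr

lemma zs_hasGrad {d n : ℕ} (f : Fin n → EuclideanSpace ℝ (Fin d) → ℝ)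
    (hdiff : ∀ i, Differentiable ℝ (f i)) (x : EuclideanSpace ℝ (Fin d)) :
    HasGradientAt (avgF f) ((n : ℝ)⁻¹ • ∑ i, gradient (f i) x) x := by
  rw [hasGradientAt_iff_hasFDerivAt]
  have h : HasFDerivAt (fun z => ∑ i, f i z) (∑ i, fderiv ℝ (f i) x) x := by
    apply HasFDerivAt.fun_sum
    intro i _
    exact (hdiff i x).hasFDerivAt
  have h2 := h.const_mul ((n : ℝ)⁻¹)
  have e : (InnerProductSpace.toDual ℝ (EuclideanSpace ℝ (Fin d)))
      ((n : ℝ)⁻¹ • ∑ i, gradient (f i) x) = (n : ℝ)⁻¹ • ∑ i, fderiv ℝ (f i) x := by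
    rw [map_smulₛₗ, map_sum]
    simp only [toDual_gradient]
    simp
  rw [e]
  exact h2

lemma zs_descent {E : Type*} [NormedAddCommGroup E] [InnerProductSpace ℝ E] [CompleteSpace E]
    (g : E → ℝ) (G : E → E) (hg : ∀ x, HasGradientAt g (G x) x) (L : ℝ)
    (hL : ∀ x y, ‖G x - G y‖ ≤ L * ‖x - y‖) (x y : E) :
    g y ≤ g x + inner ℝ (G x) (y - x) + L / 2 * ‖y - x‖ ^ 2 := by
  set v := y - x with hv
  let h : ℝ → ℝ := fun t => g (x + t • v) - t * inner ℝ (G x) v - L / 2 * ‖v‖ ^ 2 * t ^ 2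
  have hd : ∀ t, HasDerivAt h (inner ℝ (G (x + t • v)) v - inner ℝ (G x) v
      - L / 2 * ‖v‖ ^ 2 * (2 * t)) t := by
    intro t
    have h1 : HasDerivAt (fun t : ℝ => x + t • v) v t := by
      simpa using ((hasDerivAt_id t).smul_const v).const_add x
    have h2 := (hasGradientAt_iff_hasFDerivAt.1 (hg (x + t • v))).comp_hasDerivAt t h1
    have h3 : HasDerivAt (fun t : ℝ => t * inner ℝ (G x) v) (inner ℝ (G x) v) t := by
      simpa using (hasDerivAt_id t).mul_const (inner ℝ (G x) v : ℝ)
    have h4 : HasDerivAt (fun t : ℝ => L / 2 * ‖v‖ ^ 2 * t ^ 2)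
        (L / 2 * ‖v‖ ^ 2 * (2 * t)) t := by
      simpa using (hasDerivAt_pow 2 t).const_mul (L / 2 * ‖v‖ ^ 2)
    have := (h2.sub h3).sub h4
    simp only [InnerProductSpace.toDual_apply_apply] at this
    exact this
  have hanti : AntitoneOn h (Set.Icc 0 1) := by
    apply antitoneOn_of_deriv_nonpos (convex_Icc 0 1)
    · exact fun t _ => (hd t).continuousAt.continuousWithinAt
    · exact fun t _ => (hd t).differentiableAt.differentiableWithinAt
    · intro t ht
      rw [interior_Icc] at ht
      rw [(hd t).deriv, ← inner_sub_left]
      have h1 := real_inner_le_norm (G (x + t • v) - G x) v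
      have h2 := hL (x + t • v) x
      rw [add_sub_cancel_left, norm_smul, Real.norm_of_nonneg ht.1.le] at h2
      nlinarith [norm_nonneg v, mul_le_mul_of_nonneg_right h2 (norm_nonneg v)]
  have := hanti (Set.left_mem_Icc.2 zero_le_one) (Set.right_mem_Icc.2 zero_le_one) zero_le_one
  simp only [h] at this
  simp [hv] at this
  simp only [← hv] at this
  linarith

lemma zs_stepG {n : ℕ} {E : Type*} [NormedAddCommGroup E] [InnerProductSpace ℝ E]
    (hn : 2 ≤ n) (b : ℕ) (hb1 : 1 ≤ b) (hb : b ≤ n) (l : ℝ) (v : E) (a p y : Fin n → E) :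
    zsAvg b (fun I => ‖((b : ℝ)⁻¹ • ∑ i ∈ I, (a i - p i) + (1 - l) • v
        + l • ((b : ℝ)⁻¹ • ∑ i ∈ I, (p i - y i) + (n : ℝ)⁻¹ • ∑ j, y j))
        - (n : ℝ)⁻¹ • ∑ i, a i‖ ^ 2)
      ≤ (1 - l) ^ 2 * ‖v - (n : ℝ)⁻¹ • ∑ i, p i‖ ^ 2
        + ((n - b) / ((n - 1) * b)) * ((n : ℝ)⁻¹ * ∑ i, ‖(a i - p i) + l • (p i - y i)‖ ^ 2) := by
  have h := zsAvg_var hn b hb1 hb ((1 - l) • (v - (n : ℝ)⁻¹ • ∑ i, p i))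
    (fun i => (a i - p i) + l • (p i - y i))
  rw [norm_smul, mul_pow, Real.norm_eq_abs, sq_abs] at h
  refine le_trans (le_of_eq ?_) h
  congr 1
  funext I
  congr 2
  simp only [Finset.sum_add_distrib, ← Finset.smul_sum, Finset.sum_sub_distrib]
  module

lemma zs_stepG' {n : ℕ} {E : Type*} [NormedAddCommGroup E] [InnerProductSpace ℝ E]
    (hn : 2 ≤ n) (b : ℕ) (hb1 : 1 ≤ b) (hb : b ≤ n) (l : ℝ) (hl : 0 < l) (hl1 : l ≤ 1)
    (v : E) (a p y : Fin n → E) (δ : ℝ) (hδ : ∀ i, ‖a i - p i‖ ^ 2 ≤ δ) :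
    zsAvg b (fun I => ‖((b : ℝ)⁻¹ • ∑ i ∈ I, (a i - p i) + (1 - l) • v
        + l • ((b : ℝ)⁻¹ • ∑ i ∈ I, (p i - y i) + (n : ℝ)⁻¹ • ∑ j, y j))
        - (n : ℝ)⁻¹ • ∑ i, a i‖ ^ 2)
      ≤ (1 - l) * ‖v - (n : ℝ)⁻¹ • ∑ i, p i‖ ^ 2
        + 2 / b * δ + 2 * l ^ 2 / b * ((n : ℝ)⁻¹ * ∑ i, ‖p i - y i‖ ^ 2) := by
  refine (zs_stepG hn b hb1 hb l v a p y).trans ?_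
  have hn2 : (2 : ℝ) ≤ n := by exact_mod_cast hn
  have hbn : (b : ℝ) ≤ n := by exact_mod_cast hb
  have hb1' : (1 : ℝ) ≤ b := by exact_mod_cast hb1
  have hb0 : (0 : ℝ) < b := by linarith
  have hnm : (0 : ℝ) < n - 1 := by linarith
  have hC : ((n : ℝ) - b) / ((n - 1) * b) ≤ 1 / b := by
    rw [div_le_div_iff₀ (by positivity) hb0]
    nlinarith
  have hs : ∑ i, ‖(a i - p i) + l • (p i - y i)‖ ^ 2
      ≤ ∑ i : Fin n, (2 * δ + 2 * l ^ 2 * ‖p i - y i‖ ^ 2) := by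
    refine Finset.sum_le_sum fun i _ => ?_
    have h1 := norm_add_le (a i - p i) (l • (p i - y i))
    rw [norm_smul, Real.norm_of_nonneg hl.le] at h1
    have h2 : ‖(a i - p i) + l • (p i - y i)‖ ^ 2 ≤ (‖a i - p i‖ + l * ‖p i - y i‖) ^ 2 := by
      gcongr
    nlinarith [hδ i, sq_nonneg (‖a i - p i‖ - l * ‖p i - y i‖)]
  have hs' : (n : ℝ)⁻¹ * ∑ i, ‖(a i - p i) + l • (p i - y i)‖ ^ 2
      ≤ 2 * δ + 2 * l ^ 2 * ((n : ℝ)⁻¹ * ∑ i, ‖p i - y i‖ ^ 2) := by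
    refine (mul_le_mul_of_nonneg_left hs (by positivity)).trans (le_of_eq ?_)
    rw [Finset.sum_add_distrib, Finset.sum_const, ← Finset.mul_sum]
    simp
    field_simp
  have h3 : ((n : ℝ) - b) / ((n - 1) * b)
        * ((n : ℝ)⁻¹ * ∑ i, ‖(a i - p i) + l • (p i - y i)‖ ^ 2)
      ≤ 1 / b * (2 * δ + 2 * l ^ 2 * ((n : ℝ)⁻¹ * ∑ i, ‖p i - y i‖ ^ 2)) :=
    mul_le_mul hC hs' (by positivity) (by positivity)
  have h4 : (1 - l) ^ 2 * ‖v - (n : ℝ)⁻¹ • ∑ i, p i‖ ^ 2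
      ≤ (1 - l) * ‖v - (n : ℝ)⁻¹ • ∑ i, p i‖ ^ 2 := by
    gcongr
    nlinarith
  have h5 : 1 / (b : ℝ) * (2 * δ + 2 * l ^ 2 * ((n : ℝ)⁻¹ * ∑ i, ‖p i - y i‖ ^ 2))
    = 2 / b * δ + 2 * l ^ 2 / b * ((n : ℝ)⁻¹ * ∑ i, ‖p i - y i‖ ^ 2) := by ring
  linarith

lemma zs_stepH {n : ℕ} {E : Type*} [NormedAddCommGroup E] [InnerProductSpace ℝ E]
    (hn : 2 ≤ n) (b : ℕ) (hb : b ≤ n) (a y : Fin n → E) :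
    zsAvg b (fun I => (n : ℝ)⁻¹ * ∑ i, ‖a i - (if i ∈ I then a i else y i)‖ ^ 2)
      = (1 - b / n) * ((n : ℝ)⁻¹ * ∑ i, ‖a i - y i‖ ^ 2) := by
  rw [zsAvg_mul, zsAvg_sum]
  have : ∀ i, zsAvg b (fun I => ‖a i - (if i ∈ I then a i else y i)‖ ^ 2)
      = (1 - b / n) * ‖a i - y i‖ ^ 2 := by
    intro i
    have e : (fun I : Finset (Fin n) => ‖a i - (if i ∈ I then a i else y i)‖ ^ 2)
        = fun I => ‖a i - y i‖ ^ 2 + (-1) * (if i ∈ I then ‖a i - y i‖ ^ 2 else 0) := by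
      funext I
      by_cases h : i ∈ I <;> simp [h]
    rw [e, zsAvg_add, zsAvg_mul, zsAvg_mem hn b hb, zsAvg_const b hb]
    ring
  simp_rw [this]
  rw [← Finset.mul_sum]
  ring

lemma zs_stepH' {n : ℕ} {E : Type*} [NormedAddCommGroup E] [InnerProductSpace ℝ E]
    (hn : 2 ≤ n) (b : ℕ) (hb1 : 1 ≤ b) (hb : b ≤ n) (a p y : Fin n → E)
    (δ : ℝ) (hδ : ∀ i, ‖a i - p i‖ ^ 2 ≤ δ) :
    zsAvg b (fun I => (n : ℝ)⁻¹ * ∑ i, ‖a i - (if i ∈ I then a i else y i)‖ ^ 2)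
      ≤ (1 - b / (2 * n)) * ((n : ℝ)⁻¹ * ∑ i, ‖p i - y i‖ ^ 2) + 2 * n / b * δ := by
  rw [zs_stepH hn b hb]
  have hn2 : (2 : ℝ) ≤ n := by exact_mod_cast hn
  have hbn : (b : ℝ) ≤ n := by exact_mod_cast hb
  have hb1' : (1 : ℝ) ≤ b := by exact_mod_cast hb1
  have hb0 : (0 : ℝ) < b := by linarith
  have hn0 : (0 : ℝ) < n := by linarith
  have hi : ∀ i, (1 - (b : ℝ) / n) * ‖a i - y i‖ ^ 2
      ≤ (1 - b / (2 * n)) * ‖p i - y i‖ ^ 2 + 2 * n / b * δ := by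
    intro i
    obtain ⟨t, ht⟩ : ∃ t : ℝ, t = b / n := ⟨_, rfl⟩
    have ht0 : 0 < t := by rw [ht]; positivity
    have ht1 : t ≤ 1 := by rw [ht]; exact (div_le_one hn0).2 hbn
    have e1 : (b : ℝ) / (2 * n) = t / 2 := by rw [ht]; field_simp
    have e2 : 2 * (n : ℝ) / b = 2 / t := by rw [ht]; field_simp
    rw [e1, e2, ← ht]
    have h1 : ‖a i - y i‖ ≤ ‖a i - p i‖ + ‖p i - y i‖ := norm_sub_le_norm_sub_add_norm_sub _ _ _
    have h2 : ‖a i - y i‖ ^ 2 ≤ (‖a i - p i‖ + ‖p i - y i‖) ^ 2 := by gcongr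
    have h3 := hδ i
    set A := ‖a i - p i‖
    set P := ‖p i - y i‖
    have hyoung : (A + P) ^ 2 ≤ (1 + t / 2) * P ^ 2 + (1 + 2 / t) * A ^ 2 := by
      have : 0 ≤ (t * P - 2 * A) ^ 2 / (2 * t) := by positivity
      have e : (t * P - 2 * A) ^ 2 / (2 * t)
        = (1 + t / 2) * P ^ 2 + (1 + 2 / t) * A ^ 2 - (A + P) ^ 2 := by
        field_simp
        ring
      linarith
    have h4 : (1 - t) * ‖a i - y i‖ ^ 2
        ≤ (1 - t) * ((1 + t / 2) * P ^ 2 + (1 + 2 / t) * A ^ 2) := by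
      have : 0 ≤ 1 - t := by linarith
      gcongr
      linarith
    have e5 : (1 - t) * ((1 + t / 2) * P ^ 2 + (1 + 2 / t) * A ^ 2)
      = (1 - t / 2 - t ^ 2 / 2) * P ^ 2 + (2 / t - 1 - t) * A ^ 2 := by
      field_simp
      ring
    have h6 : 2 / t * A ^ 2 ≤ 2 / t * δ := by gcongr
    nlinarith [sq_nonneg P, sq_nonneg A, mul_nonneg (sq_nonneg t) (sq_nonneg P),
      mul_nonneg ht0.le (sq_nonneg A)]
  calc (1 - (b : ℝ) / n) * ((n : ℝ)⁻¹ * ∑ i, ‖a i - y i‖ ^ 2)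
      = (n : ℝ)⁻¹ * ∑ i, (1 - (b : ℝ) / n) * ‖a i - y i‖ ^ 2 := by
        rw [← Finset.mul_sum]; ring
    _ ≤ (n : ℝ)⁻¹ * ∑ i : Fin n, ((1 - b / (2 * n)) * ‖p i - y i‖ ^ 2 + 2 * n / b * δ) := by
        gcongr with i
        exact hi i
    _ = _ := by
        rw [Finset.sum_add_distrib, ← Finset.mul_sum]
        simp
        field_simp

abbrev ZSt (d n : ℕ) : Type := EuclideanSpace ℝ (Fin d) × EuclideanSpace ℝ (Fin d) ×
      EuclideanSpace ℝ (Fin d) × (Fin n → EuclideanSpace ℝ (Fin d))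

/-- One step of the process as a function of the state. -/
def zsStep {d n : ℕ} (f : Fin n → EuclideanSpace ℝ (Fin d) → ℝ)
    (η lam : ℕ → ℝ) (b : ℕ → ℕ) (k : ℕ) (I : Finset (Fin n)) (st : ZSt d n) : ZSt d n :=
  let v : EuclideanSpace ℝ (Fin d) :=
        (b k : ℝ)⁻¹ • ∑ i ∈ I, (gradient (f i) st.1 - gradient (f i) st.2.1)
          + (1 - lam k) • st.2.2.1
          + lam k • ((b k : ℝ)⁻¹ • ∑ i ∈ I, (gradient (f i) st.2.1 - st.2.2.2 i)
              + (n : ℝ)⁻¹ • ∑ j, st.2.2.2 j)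
  (st.1 - η k • v, st.1, v, fun i => if i ∈ I then gradient (f i) st.1 else st.2.2.2 i)

lemma zsState_succ {d n : ℕ} (f : Fin n → EuclideanSpace ℝ (Fin d) → ℝ)
    (η lam : ℕ → ℝ) (b : ℕ → ℕ) (x0 : EuclideanSpace ℝ (Fin d))
    (ω : ℕ → Finset (Fin n)) (k : ℕ) :
    zsState f η lam b x0 ω (k + 1) = zsStep f η lam b k (ω k) (zsState f η lam b x0 ω k) := rfl

lemma zsState_congr {d n : ℕ} (f : Fin n → EuclideanSpace ℝ (Fin d) → ℝ)
    (η lam : ℕ → ℝ) (b : ℕ → ℕ) (x0 : EuclideanSpace ℝ (Fin d))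
    (ω ω' : ℕ → Finset (Fin n)) (k : ℕ) (h : ∀ j < k, ω j = ω' j) :
    zsState f η lam b x0 ω k = zsState f η lam b x0 ω' k := by
  induction k with
  | zero => rfl
  | succ k ih =>
    rw [zsState_succ, zsState_succ, ih (fun j hj => h j (by omega)), h k (by omega)]

lemma zs_sum_snoc {n : ℕ} (b : ℕ → ℕ) (k : ℕ) (F : (Fin (k + 1) → Finset (Fin n)) → ℝ) :
    ∑ τ ∈ Finset.univ.filter
      (fun τ : Fin (k + 1) → Finset (Fin n) => ∀ j : Fin (k + 1), (τ j).card = b j.val), F τ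
    = ∑ τ ∈ Finset.univ.filter
      (fun τ : Fin k → Finset (Fin n) => ∀ j : Fin k, (τ j).card = b j.val),
      ∑ I ∈ Finset.powersetCard (b k) (Finset.univ : Finset (Fin n)),
        F (Fin.snoc (α := fun _ => Finset (Fin n)) τ I) := by
  rw [← Finset.sum_product']
  refine Finset.sum_nbij' (fun τ => (Fin.init τ, τ (Fin.last k)))
    (fun q => Fin.snoc (α := fun _ => Finset (Fin n)) q.1 q.2) ?_ ?_ ?_ ?_ ?_
  · intro τ hτ
    simp only [Finset.mem_filter, Finset.mem_univ, true_and, Finset.mem_product,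
      Finset.mem_powersetCard, Finset.subset_univ] at hτ ⊢
    exact ⟨fun j => hτ j.castSucc, hτ (Fin.last k)⟩
  · rintro ⟨τ, I⟩ h
    simp only [Finset.mem_filter, Finset.mem_univ, true_and, Finset.mem_product,
      Finset.mem_powersetCard, Finset.subset_univ] at h ⊢
    intro j
    refine Fin.lastCases ?_ (fun j => ?_) j
    · simpa using h.2
    · simpa using h.1 j
  · intro τ _
    exact Fin.snoc_init_self τ
  · rintro ⟨τ, I⟩ _
    simp
  · intro τ _
    simp [Fin.snoc_init_self]

lemma zs_tower {d n : ℕ} (f : Fin n → EuclideanSpace ℝ (Fin d) → ℝ)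
    (η lam : ℕ → ℝ) (b : ℕ → ℕ) (x0 : EuclideanSpace ℝ (Fin d)) (k : ℕ) (φ : ZSt d n → ℝ) :
    zsExpK b (k + 1) (fun ω => φ (zsState f η lam b x0 ω (k + 1)))
      = zsExpK b k (fun ω => zsAvg (b k)
          (fun I => φ (zsStep f η lam b k I (zsState f η lam b x0 ω k)))) := by
  have hcard := zs_sum_snoc (n := n) b k (fun _ => 1)
  simp only [Finset.sum_const, nsmul_eq_mul, mul_one, Finset.card_powersetCard,
    Finset.card_univ, Fintype.card_fin] at hcard
  unfold zsExpK
  rw [hcard, zs_sum_snoc]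
  simp only [zsAvg]
  rw [← Finset.sum_div, div_div, mul_comm (Nat.cast (Finset.card _))]
  congr 1
  refine Finset.sum_congr rfl fun τ _ => Finset.sum_congr rfl fun I _ => ?_
  rw [zsState_succ]
  congr 2
  · rw [dif_pos (Nat.lt_succ_self k)]
    exact Fin.snoc_last (α := fun _ => Finset (Fin n)) I τ
  · apply zsState_congr
    intro j hj
    rw [dif_pos (by omega), dif_pos hj]
    exact Fin.snoc_castSucc (α := fun _ => Finset (Fin n)) I τ ⟨j, hj⟩

lemma zsExpK_mono {n : ℕ} (b : ℕ → ℕ) (k : ℕ) (g h : (ℕ → Finset (Fin n)) → ℝ)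
    (hgh : ∀ ω, g ω ≤ h ω) : zsExpK b k g ≤ zsExpK b k h := by
  unfold zsExpK
  gcongr
  exact hgh _

lemma zsExpK_sub {n : ℕ} (b : ℕ → ℕ) (k : ℕ) (g h : (ℕ → Finset (Fin n)) → ℝ) (c : ℝ) :
    zsExpK b k (fun ω => g ω - c * h ω) = zsExpK b k g - c * zsExpK b k h := by
  unfold zsExpK
  rw [Finset.sum_sub_distrib, ← Finset.mul_sum]
  ring

lemma zsExpK_const {n : ℕ} (b : ℕ → ℕ) (hb : ∀ k, b k ≤ n) (k : ℕ) (c : ℝ) :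
    zsExpK (n := n) b k (fun _ => c) = c := by
  unfold zsExpK
  have : ((Finset.univ.filter
      (fun τ : Fin k → Finset (Fin n) => ∀ j : Fin k, (τ j).card = b j.val)).card : ℝ) ≠ 0 := by
    have h : ∀ j : Fin k, ∃ s : Finset (Fin n), s.card = b j.val := by
      intro j
      obtain ⟨s, _, hs⟩ := Finset.exists_subset_card_eq (s := (Finset.univ : Finset (Fin n)))
        (n := b j.val) (by simpa using hb j.val)
      exact ⟨s, hs⟩
    choose τ hτ using h
    have : 0 < (Finset.univ.filter
      (fun τ : Fin k → Finset (Fin n) => ∀ j : Fin k, (τ j).card = b j.val)).card :=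
      Finset.card_pos.2 ⟨τ, by simpa using hτ⟩
    exact_mod_cast this.ne'
  rw [Finset.sum_const, nsmul_eq_mul, mul_div_cancel_left₀ _ this]

lemma zs_numeric (n b L η l γ' α' M G G' H H' D N S fx fp : ℝ)
    (hn : 0 < n) (hb : 0 < b) (hbn : b ≤ n) (hL : 0 < L) (hη : 0 < η) (hl : 0 < l) (hl1 : l ≤ 1)
    (hM : M = 2 / (l * b) + 8 * l * n ^ 2 / b ^ 3)
    (hstep : η ≤ 1 / (L * (1 + Real.sqrt M)))
    (hγ0 : 0 ≤ γ') (hα0 : 0 ≤ α')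
    (hγ : γ' ≤ η / (2 * l)) (hα : α' ≤ 2 * n * l * η / b ^ 2)
    (hG : 0 ≤ G) (hH : 0 ≤ H) (hN : 0 ≤ N)
    (hD : D = η ^ 2 * N)
    (hG' : G' ≤ (1 - l) * G + 2 / b * (L ^ 2 * D) + 2 * l ^ 2 / b * H)
    (hH' : H' ≤ (1 - b / (2 * n)) * H + 2 * n / b * (L ^ 2 * D))
    (hf : fx ≤ fp + η / 2 * (G - S - N) + L / 2 * D) :
    fx + γ' * G' + α' * H' ≤ fp + η / (2 * l) * G + 2 * n * l * η / b ^ 2 * H - η / 2 * S := by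
  have hM0 : 0 ≤ M := by rw [hM]; positivity
  have hD0 : 0 ≤ D := by rw [hD]; positivity
  have hbn' : 0 ≤ 1 - b / (2 * n) := by
    rw [sub_nonneg, div_le_one (by positivity)]; linarith
  have hu : L ^ 2 * η ^ 2 * M + L * η ≤ 1 := by
    rw [le_div_iff₀ (by positivity)] at hstep
    have hs := Real.sq_sqrt hM0
    have hs0 := Real.sqrt_nonneg M
    set s := Real.sqrt M
    have h1 : L * η * s ≤ 1 - L * η := by linarith
    have h0 : 0 ≤ L * η * s := by positivity
    have h2 : 0 < L * η := by positivity
    have h3 : L ^ 2 * η ^ 2 * M = (L * η * s) ^ 2 := by rw [← hs]; ring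
    rw [h3]
    nlinarith
  have a1 : γ' * G' ≤ η / (2 * l) * ((1 - l) * G + 2 / b * (L ^ 2 * D) + 2 * l ^ 2 / b * H) := by
    refine (mul_le_mul_of_nonneg_left hG' hγ0).trans (mul_le_mul_of_nonneg_right hγ ?_)
    have : 0 ≤ 1 - l := by linarith
    positivity
  have a2 : α' * H' ≤ 2 * n * l * η / b ^ 2 * ((1 - b / (2 * n)) * H + 2 * n / b * (L ^ 2 * D)) := by
    refine (mul_le_mul_of_nonneg_left hH' hα0).trans (mul_le_mul_of_nonneg_right hα ?_)
    positivity
  have e1 : η / (2 * l) * ((1 - l) * G + 2 / b * (L ^ 2 * D) + 2 * l ^ 2 / b * H)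
      + 2 * n * l * η / b ^ 2 * ((1 - b / (2 * n)) * H + 2 * n / b * (L ^ 2 * D))
      = η / (2 * l) * G - η / 2 * G + 2 * n * l * η / b ^ 2 * H + η / 2 * (L ^ 2 * D * M) := by
    rw [hM]
    field_simp
    ring
  have e2 : η / 2 * (L ^ 2 * D * M) + L / 2 * D ≤ η / 2 * N := by
    have : η / 2 * (L ^ 2 * D * M) + L / 2 * D = η / 2 * N * (L ^ 2 * η ^ 2 * M + L * η) := by
      rw [hD]; ring
    rw [this]
    have h0 : 0 ≤ η / 2 * N := by positivity
    nlinarith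
  linarith

/-- Lyapunov function -/
def zsV {d n : ℕ} (f : Fin n → EuclideanSpace ℝ (Fin d) → ℝ) (γ α : ℝ) (st : ZSt d n) : ℝ :=
  avgF f st.2.1 + γ * ‖st.2.2.1 - gradient (avgF f) st.2.1‖ ^ 2
    + α * ((n : ℝ)⁻¹ * ∑ i, ‖gradient (f i) st.2.1 - st.2.2.2 i‖ ^ 2)

lemma zsV_avg {d n : ℕ} (f : Fin n → EuclideanSpace ℝ (Fin d) → ℝ)
    (hdiff : ∀ i, Differentiable ℝ (f i)) (η lam : ℕ → ℝ) (b : ℕ → ℕ) (hb : ∀ k, b k ≤ n)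
    (γ α : ℝ) (k : ℕ) (st : ZSt d n) :
    zsAvg (b k) (fun I => zsV f γ α (zsStep f η lam b k I st))
      = avgF f st.1
        + γ * zsAvg (b k) (fun I : Finset (Fin n) =>
          ‖((b k : ℝ)⁻¹ • ∑ i ∈ I, (gradient (f i) st.1 - gradient (f i) st.2.1)
            + (1 - lam k) • st.2.2.1
            + lam k • ((b k : ℝ)⁻¹ • ∑ i ∈ I, (gradient (f i) st.2.1 - st.2.2.2 i)
              + (n : ℝ)⁻¹ • ∑ j, st.2.2.2 j)) - (n : ℝ)⁻¹ • ∑ i, gradient (f i) st.1‖ ^ 2)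
        + α * zsAvg (b k) (fun I : Finset (Fin n) => (n : ℝ)⁻¹ * ∑ i, ‖gradient (f i) st.1
            - (if i ∈ I then gradient (f i) st.1 else st.2.2.2 i)‖ ^ 2) := by
  rw [← (zs_hasGrad f hdiff st.1).gradient, ← zsAvg_mul, ← zsAvg_mul]
  have hc := zsAvg_const (n := n) (b k) (hb k) (avgF f st.1)
  rw [← hc, ← zsAvg_add, ← zsAvg_add]
  rfl

set_option maxHeartbeats 1000000 in
lemma zs_onestep {d n : ℕ} (hn : 2 ≤ n) (L : ℝ) (hL : 0 < L)
    (f : Fin n → EuclideanSpace ℝ (Fin d) → ℝ)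
    (hdiff : ∀ i, Differentiable ℝ (f i))
    (hsmooth : ∀ i (x y : EuclideanSpace ℝ (Fin d)),
      ‖gradient (f i) x - gradient (f i) y‖ ≤ L * ‖x - y‖)
    (η lam : ℕ → ℝ) (b : ℕ → ℕ)
    (hηpos : ∀ k, 0 < η k)
    (hb : ∀ k, 1 ≤ b k ∧ b k ≤ n)
    (hlam : ∀ k, 1 ≤ k → lam k ∈ Set.Ioc (0 : ℝ) 1)
    (hηk : ∀ k, η k ≤ 1 / (L * (1 + Real.sqrt
      (2 / (lam (k + 1) * (b (k + 1) : ℝ))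
        + 8 * lam (k + 1) * (n : ℝ) ^ 2 / (b (k + 1) : ℝ) ^ 3))))
    (hmono1 : ∀ k, η (k + 1) / lam (k + 2) ≤ η k / lam (k + 1))
    (hmono2 : ∀ k, lam (k + 2) * η (k + 1) / (b (k + 2) : ℝ) ^ 2
      ≤ lam (k + 1) * η k / (b (k + 1) : ℝ) ^ 2)
    (k : ℕ) (st : ZSt d n) (hst : st.1 = st.2.1 - η k • st.2.2.1) :
    zsAvg (b (k + 1)) (fun I => zsV f (η (k + 1) / (2 * lam (k + 2)))
        (2 * n * lam (k + 2) * η (k + 1) / (b (k + 2) : ℝ) ^ 2) (zsStep f η lam b (k + 1) I st))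
      ≤ zsV f (η k / (2 * lam (k + 1))) (2 * n * lam (k + 1) * η k / (b (k + 1) : ℝ) ^ 2) st
        - η k / 2 * ‖gradient (avgF f) st.2.1‖ ^ 2 := by
  rw [zsV_avg f hdiff η lam b (fun k => (hb k).2)]
  obtain ⟨x, xp, v, y⟩ := st
  simp only at hst
  have hn2 : (2 : ℝ) ≤ n := by exact_mod_cast hn
  have hn0 : (0 : ℝ) < n := by linarith
  have hbp : ∀ k, (0 : ℝ) < b k := fun k => by exact_mod_cast (hb k).1
  have hgrad : ∀ z, gradient (avgF f) z = (n : ℝ)⁻¹ • ∑ i, gradient (f i) z :=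
    fun z => (zs_hasGrad f hdiff z).gradient
  have hl := hlam (k + 1) (by omega)
  have hl2 := hlam (k + 2) (by omega)
  have hη := hηpos k
  have hη1 := hηpos (k + 1)
  have hδ : ∀ i, ‖gradient (f i) x - gradient (f i) xp‖ ^ 2 ≤ L ^ 2 * ‖x - xp‖ ^ 2 := by
    intro i
    rw [← mul_pow]
    exact pow_le_pow_left₀ (norm_nonneg _) (hsmooth i x xp) 2
  have hLip : ∀ z w, ‖gradient (avgF f) z - gradient (avgF f) w‖ ≤ L * ‖z - w‖ := by
    intro z w
    rw [hgrad, hgrad, ← smul_sub, ← Finset.sum_sub_distrib, norm_smul]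
    have h1 : ‖∑ i, (gradient (f i) z - gradient (f i) w)‖ ≤ ∑ i : Fin n, L * ‖z - w‖ :=
      (norm_sum_le _ _).trans (Finset.sum_le_sum fun i _ => hsmooth i z w)
    rw [Finset.sum_const, Finset.card_univ, Fintype.card_fin, nsmul_eq_mul] at h1
    rw [norm_inv, Real.norm_of_nonneg hn0.le, inv_mul_le_iff₀ hn0]
    exact h1
  have hG := zs_stepG' hn (b (k + 1)) (hb _).1 (hb _).2 (lam (k + 1)) hl.1 hl.2 v
    (fun i => gradient (f i) x) (fun i => gradient (f i) xp) y _ hδ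
  have hH := zs_stepH' hn (b (k + 1)) (hb _).1 (hb _).2
    (fun i => gradient (f i) x) (fun i => gradient (f i) xp) y _ hδ
  have hdesc := zs_descent (avgF f) (gradient (avgF f))
    (fun z => (zs_hasGrad f hdiff z).differentiableAt.hasGradientAt) L hLip xp x
  have hxx : x - xp = -(η k • v) := by rw [hst]; abel
  have hD : ‖x - xp‖ ^ 2 = η k ^ 2 * ‖v‖ ^ 2 := by
    rw [hxx, norm_neg, norm_smul, mul_pow, Real.norm_eq_abs, sq_abs]
  have hinner : (inner ℝ (gradient (avgF f) xp) (x - xp) : ℝ)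
      = η k / 2 * (‖v - gradient (avgF f) xp‖ ^ 2 - ‖gradient (avgF f) xp‖ ^ 2 - ‖v‖ ^ 2) := by
    rw [hxx, inner_neg_right, inner_smul_right, norm_sub_sq_real, real_inner_comm]
    ring
  rw [hinner] at hdesc
  rw [← hgrad xp] at hG
  have hγ1 : 0 ≤ η (k + 1) / (2 * lam (k + 2)) := by
    have := hl2.1
    positivity
  have hα1 : 0 ≤ 2 * n * lam (k + 2) * η (k + 1) / (b (k + 2) : ℝ) ^ 2 := by
    have := hl2.1
    positivity
  have hγ2 : η (k + 1) / (2 * lam (k + 2)) ≤ η k / (2 * lam (k + 1)) := by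
    have e : ∀ p q : ℝ, p / (2 * q) = (1 / 2) * (p / q) := fun p q => by
      rw [mul_comm 2 q, ← div_div]; ring
    rw [e, e]
    linarith [hmono1 k]
  have hα2 : 2 * n * lam (k + 2) * η (k + 1) / (b (k + 2) : ℝ) ^ 2
      ≤ 2 * n * lam (k + 1) * η k / (b (k + 1) : ℝ) ^ 2 := by
    have e : ∀ p q r : ℝ, 2 * (n : ℝ) * p * q / r = (2 * n) * (p * q / r) := fun p q r => by ring
    rw [e, e]
    have h2n : (0 : ℝ) ≤ 2 * (n : ℝ) := by linarith
    have hm := mul_le_mul_of_nonneg_left (hmono2 k) h2n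
    exact hm
  have hGn : 0 ≤ ‖v - gradient (avgF f) xp‖ ^ 2 := by positivity
  have hHn : 0 ≤ (n : ℝ)⁻¹ * ∑ i, ‖gradient (f i) xp - y i‖ ^ 2 :=
    mul_nonneg (inv_nonneg.2 hn0.le) (Finset.sum_nonneg fun i _ => sq_nonneg _)
  have hNn : 0 ≤ ‖v‖ ^ 2 := by positivity
  have hbnr : (b (k + 1) : ℝ) ≤ n := by exact_mod_cast (hb (k + 1)).2
  dsimp only [zsV] at hG hH ⊢
  generalize zsAvg (b (k + 1)) (fun I : Finset (Fin n) => (n : ℝ)⁻¹ * ∑ i, ‖gradient (f i) x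
            - (if i ∈ I then gradient (f i) x else y i)‖ ^ 2) = H' at hH ⊢
  generalize zsAvg (b (k + 1)) _ = G' at hG ⊢
  generalize (n : ℝ)⁻¹ * ∑ i, ‖gradient (f i) xp - y i‖ ^ 2 = H at hG hH hHn ⊢
  generalize ‖v - gradient (avgF f) xp‖ ^ 2 = G at hG hdesc hGn ⊢
  have hnum := zs_numeric n (b (k + 1)) L (η k) (lam (k + 1)) _ _ _ G G' H H' _ _ _ _ _
    hn0 (hbp (k + 1)) hbnr hL hη hl.1 hl.2 rfl
    (hηk k) hγ1 hα1 hγ2 hα2 hGn hHn hNn hD hG hH hdesc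
  exact hnum

/-- Theorem 1 (convergence of ZeroSARAH). -/
theorem zerosarah_theorem1 {d n : ℕ} (hd : 1 ≤ d) (hn : 2 ≤ n)
    (L : ℝ) (hL : 0 < L)
    (f : Fin n → EuclideanSpace ℝ (Fin d) → ℝ)
    (hdiff : ∀ i, Differentiable ℝ (f i))
    (hsmooth : ∀ i (x y : EuclideanSpace ℝ (Fin d)),
      ‖gradient (f i) x - gradient (f i) y‖ ≤ L * ‖x - y‖)
    (x0 : EuclideanSpace ℝ (Fin d))
    (η lam : ℕ → ℝ) (b : ℕ → ℕ)
    (hηpos : ∀ k, 0 < η k)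
    (hb : ∀ k, 1 ≤ b k ∧ b k ≤ n)
    (hlam0 : lam 0 = 1)
    (hlam : ∀ k, 1 ≤ k → lam k ∈ Set.Ioc (0 : ℝ) 1)
    (hηk : ∀ k, η k ≤ 1 / (L * (1 + Real.sqrt
      (2 / (lam (k + 1) * (b (k + 1) : ℝ))
        + 8 * lam (k + 1) * (n : ℝ) ^ 2 / (b (k + 1) : ℝ) ^ 3))))
    (hmono1 : ∀ k, η (k + 1) / lam (k + 2) ≤ η k / lam (k + 1))
    (hmono2 : ∀ k, lam (k + 2) * η (k + 1) / (b (k + 2) : ℝ) ^ 2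
      ≤ lam (k + 1) * η k / (b (k + 1) : ℝ) ^ 2)
    (fstar : ℝ) (hfstar : IsGLB (Set.range (avgF f)) fstar)
    (γ0 α0 : ℝ)
    (hγ0 : γ0 ≥ η 0 / (2 * lam 1))
    (hα0 : α0 ≥ 2 * (n : ℝ) * lam 1 * η 0 / (b 1 : ℝ) ^ 2)
    (K : ℕ) (hK : 1 ≤ K) :
    ∑ k ∈ Finset.range K, η k *
        zsExpK b k (fun ω => ‖gradient (avgF f) ((zsState f η lam b x0 ω k).1)‖ ^ 2)
      ≤ 2 * (avgF f x0 - fstar)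
        + ((n : ℝ) - (b 0 : ℝ)) * (4 * γ0 + 2 * α0 * (b 0 : ℝ)) / ((n : ℝ) * (b 0 : ℝ))
          * ((n : ℝ)⁻¹ * ∑ i, ‖gradient (f i) x0‖ ^ 2) := by
  have hn2 : (2 : ℝ) ≤ n := by exact_mod_cast hn
  have hn0 : (0 : ℝ) < n := by linarith
  have hbp : ∀ k, (1 : ℝ) ≤ b k := fun k => by exact_mod_cast (hb k).1
  have hbn : ∀ k, (b k : ℝ) ≤ n := fun k => by exact_mod_cast (hb k).2
  set γ : ℕ → ℝ := fun k => η k / (2 * lam (k + 1)) with hγ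
  set α : ℕ → ℝ := fun k => 2 * n * lam (k + 1) * η k / (b (k + 1) : ℝ) ^ 2 with hα
  have hγpos : ∀ k, 0 ≤ γ k := fun k => by
    have := (hlam (k + 1) (by omega)).1
    have := hηpos k
    simp only [hγ]
    positivity
  have hαpos : ∀ k, 0 ≤ α k := fun k => by
    have := (hlam (k + 1) (by omega)).1
    have := hηpos k
    simp only [hα]
    positivity
  let S : ℕ → ℝ := fun k =>
    zsExpK b k (fun ω => ‖gradient (avgF f) ((zsState f η lam b x0 ω k).1)‖ ^ 2)
  let V : ℕ → ℝ := fun k =>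
    zsExpK b (k + 1) (fun ω => zsV f (γ k) (α k) (zsState f η lam b x0 ω (k + 1)))
  have hS : ∀ k, zsExpK b (k + 1)
      (fun ω => ‖gradient (avgF f) ((zsState f η lam b x0 ω (k + 1)).2.1)‖ ^ 2) = S k := by
    intro k
    rw [zs_tower f η lam b x0 k (fun st => ‖gradient (avgF f) st.2.1‖ ^ 2)]
    simp only [zsStep, S]
    simp_rw [zsAvg_const (n := n) (b k) (hb k).2]
  have hstep : ∀ k, V (k + 1) ≤ V k - η k / 2 * S k := by
    intro k
    rw [← hS k]
    simp only [V]
    rw [zs_tower, ← zsExpK_sub]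
    refine zsExpK_mono _ _ _ _ fun ω => ?_
    exact zs_onestep hn L hL f hdiff hsmooth η lam b hηpos hb hlam hηk hmono1 hmono2 k _ rfl
  have hsum : ∀ K, V K + ∑ k ∈ Finset.range K, η k / 2 * S k ≤ V 0 := by
    intro K
    induction K with
    | zero => simp
    | succ K ih =>
      rw [Finset.sum_range_succ]
      linarith [hstep K]
  have hlow : fstar ≤ V K := by
    rw [← zsExpK_const (n := n) b (fun k => (hb k).2) (K + 1) fstar]
    refine zsExpK_mono _ _ _ _ fun ω => ?_
    have h1 := hfstar.1 ⟨(zsState f η lam b x0 ω (K + 1)).2.1, rfl⟩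
    have h2 := hγpos K
    have h3 := hαpos K
    simp only [zsV]
    have h4 : 0 ≤ γ K * ‖(zsState f η lam b x0 ω (K + 1)).2.2.1
      - gradient (avgF f) (zsState f η lam b x0 ω (K + 1)).2.1‖ ^ 2 := by positivity
    have h5 : 0 ≤ α K * ((n : ℝ)⁻¹ * ∑ i, ‖gradient (f i) (zsState f η lam b x0 ω (K + 1)).2.1
      - (zsState f η lam b x0 ω (K + 1)).2.2.2 i‖ ^ 2) := by positivity
    linarith
  set G0 : ℝ := (n : ℝ)⁻¹ * ∑ i, ‖gradient (f i) x0‖ ^ 2 with hG0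
  have hG0pos : 0 ≤ G0 := by positivity
  have hV0 : V 0 ≤ avgF f x0 + γ 0 * (((n - b 0) / ((n - 1) * b 0)) * G0)
      + α 0 * ((1 - b 0 / n) * G0) := by
    have e : V 0 = zsExpK (n := n) b 0 (fun _ => zsAvg (b 0) (fun I => zsV f (γ 0) (α 0)
        (zsStep f η lam b 0 I ((x0, x0, 0, fun _ => 0) : ZSt d n)))) := by
      simp only [V]
      rw [zs_tower f η lam b x0 0]
      rfl
    rw [e, zsExpK_const b (fun k => (hb k).2), zsV_avg f hdiff η lam b (fun k => (hb k).2)]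
    have hG := zs_stepG hn (b 0) (hb 0).1 (hb 0).2 (lam 0) (0 : EuclideanSpace ℝ (Fin d))
      (fun i => gradient (f i) x0) (fun i => gradient (f i) x0) (fun _ => 0)
    have hH := zs_stepH hn (b 0) (hb 0).2 (fun i => gradient (f i) x0) (fun _ => 0)
    have hG2 : (1 - lam 0) ^ 2 * ‖(0 : EuclideanSpace ℝ (Fin d))
        - (n : ℝ)⁻¹ • ∑ i, gradient (f i) x0‖ ^ 2
        + (((n : ℝ) - b 0) / ((n - 1) * b 0)) * ((n : ℝ)⁻¹ * ∑ i, ‖(gradient (f i) x0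
          - gradient (f i) x0) + lam 0 • (gradient (f i) x0 - 0)‖ ^ 2)
        = (((n : ℝ) - b 0) / ((n - 1) * b 0)) * G0 := by
      simp [hlam0, hG0]
    rw [hG2] at hG
    have hH2 : (n : ℝ)⁻¹ * ∑ i, ‖gradient (f i) x0 - 0‖ ^ 2 = G0 := by simp [hG0]
    rw [hH2] at hH
    have h1 := mul_le_mul_of_nonneg_left hG (hγpos 0)
    have h2 := congrArg (fun t => α 0 * t) hH
    exact add_le_add (add_le_add le_rfl h1) h2.le
  have hfin := hsum K
  have hsum2 : ∑ k ∈ Finset.range K, η k * S k = 2 * ∑ k ∈ Finset.range K, η k / 2 * S k := by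
    rw [Finset.mul_sum]
    exact Finset.sum_congr rfl fun k _ => by ring
  change ∑ k ∈ Finset.range K, η k * S k ≤ _
  rw [hsum2]
  have hb0 := hbp 0
  have hbn0 := hbn 0
  have hnb : (0 : ℝ) ≤ n - b 0 := by linarith
  have hnm : (0 : ℝ) < n - 1 := by linarith
  have hc1 : 2 * (γ 0 * (((n - b 0) / ((n - 1) * b 0)) * G0))
      ≤ 4 * γ0 * ((n - b 0) / (n * b 0) * G0) := by
    have h1 : ((n : ℝ) - b 0) / ((n - 1) * b 0) ≤ 2 * ((n - b 0) / (n * b 0)) := by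
      rw [← mul_div_assoc, div_le_div_iff₀ (by positivity) (by positivity)]
      have : 0 ≤ ((n : ℝ) - b 0) * b 0 * (n - 2) := by
        have : (0 : ℝ) ≤ n - 2 := by linarith
        positivity
      nlinarith
    have h2 : γ 0 * (((n - b 0) / ((n - 1) * b 0)) * G0)
        ≤ γ0 * (2 * ((n - b 0) / (n * b 0)) * G0) := by
      have h0 : γ 0 ≤ γ0 := hγ0
      have := hγpos 0
      gcongr
      exact this.trans h0
    linarith
  have hc2 : 2 * (α 0 * ((1 - b 0 / n) * G0)) ≤ 2 * α0 * b 0 * ((n - b 0) / (n * b 0) * G0) := by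
    have e : (1 - (b 0 : ℝ) / n) = b 0 * ((n - b 0) / (n * b 0)) := by
      field_simp
    rw [e]
    have h0 : α 0 ≤ α0 := hα0
    have h1 : 0 ≤ (b 0 : ℝ) * ((n - b 0) / (n * b 0)) * G0 := by positivity
    linarith [mul_le_mul_of_nonneg_right h0 h1]
  have e3 : ((n : ℝ) - b 0) * (4 * γ0 + 2 * α0 * b 0) / (n * b 0) * G0
      = 4 * γ0 * ((n - b 0) / (n * b 0) * G0) + 2 * α0 * b 0 * ((n - b 0) / (n * b 0) * G0) := by
    ring
  rw [e3]
  linarith
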